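/- Let M₁ be the Turing machine with states {A,B,C,H} and symbols {0,1,2} whose transition table is: δ(A,0)=(1,R,B), δ(A,1)=(2,L,A), δ(A,2)=(1,L,C); δ(B,0)=(0,L,A), δ(B,1)=(2,R,B), δ(B,2)=(1,L,B); δ(C,0)=(1,R,H), δ(C,1)=(1,R,A), δ(C,2)=(1,R,C). Let C(n) = ^ω0 (A0) 2^n 0^ω. Then: (a) ^ω0 (A0) 0^ω ⊢(3) C(1); and for all k ≥ 0: (b) C(8k+1) ⊢(112k²+116k+13) C(14k+3); (c) C(8k+2) ⊢(112k²+144k+38) C(14k+7); (d) C(8k+3) ⊢(112k²+172k+54) C(14k+8); (e) C(8k+4) ⊢(112k²+200k+74) C(14k+9); (f) C(8k+5) ⊢(112k²+228k+97) ^ω0 1 (H1) 2^{14k+9} 0^ω; (g) C(8k+6) ⊢(112k²+256k+139) C(14k+14); (h) C(8k+7) ⊢(112k²+284k+169) C(14k+15); (i) C(8k+8) ⊢(112k²+312k+203) C(14k+16). -/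

import Mathlib

open Turing

inductive TSt where | A | B | C | H
deriving DecidableEq

inductive Gam where | s0 | s1 | s2
deriving DecidableEq

instance : Inhabited Gam := ⟨Gam.s0⟩

abbrev Cfg := TSt × Tape Gam

/-- The transition table of the machine (values from the halting state `H` are never used). -/
def delta : TSt → Gam → Gam × Dir × TSt
  | .A, .s0 => (.s1, Dir.right, .B)
  | .A, .s1 => (.s2, Dir.left, .A)
  | .A, .s2 => (.s1, Dir.left, .C)
  | .B, .s0 => (.s0, Dir.left, .A)
  | .B, .s1 => (.s2, Dir.right, .B)
  | .B, .s2 => (.s1, Dir.left, .B)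
  | .C, .s0 => (.s1, Dir.right, .H)
  | .C, .s1 => (.s1, Dir.right, .A)
  | .C, .s2 => (.s1, Dir.right, .C)
  | .H, a => (a, Dir.right, .H)

/-- One computation step; `none` if the current state is the halting state `H`. -/
def step (c : Cfg) : Option Cfg :=
  if c.1 = TSt.H then none
  else
    let t := delta c.1 c.2.head
    some (t.2.2, (c.2.write t.1).move t.2.1)

/-- `reaches t c₁ c₂` : iterating `step` exactly `t` times starting from `c₁` yields `c₂`. -/
def reaches (t : ℕ) (c₁ c₂ : Cfg) : Prop :=
  (fun c => Option.bind c step)^[t] (some c₁) = some c₂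

/-- The configuration `^ω0 x (q a) y 0^ω` : state `q`, head reading `a`, the word `x`
written immediately to the left of the head (in order), `y` immediately to the right,
blank elsewhere. -/
def mkCfg (x : List Gam) (q : TSt) (a : Gam) (y : List Gam) : Cfg :=
  (q, ⟨a, ListBlank.mk x.reverse, ListBlank.mk y⟩)

/-- `C(n) = ^ω0 (A0) 2^n 0^ω`. -/
def Cfg1 (n : ℕ) : Cfg := mkCfg [] .A .s0 (List.replicate n .s2)

theorem reaches_trans {s t : ℕ} {c₁ c₂ c₃ : Cfg} (h₁ : reaches s c₁ c₂) (h₂ : reaches t c₂ c₃) :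
    reaches (s + t) c₁ c₃ := by
  unfold reaches at *
  rw [Nat.add_comm, Function.iterate_add_apply, h₁, h₂]

theorem reaches_congr {s t : ℕ} {c d c' d' : Cfg} (h : reaches s c d) (hst : t = s)
    (hc : c' = c) (hd : d' = d) : reaches t c' d' := by
  subst hst hc hd
  exact h

/-- The configuration in state `q` with the cells left of the head listed outwards in `L`, and
the cells from the head rightwards listed in `R`. -/
def conf (q : TSt) (L R : List Gam) : Cfg :=
  (q, Tape.mk' (ListBlank.mk L) (ListBlank.mk R))

theorem ListBlank.mk_append_blank (l : List Gam) :
    ListBlank.mk (l ++ [Gam.s0]) = ListBlank.mk l :=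
  (Quotient.sound' (Or.inl ⟨1, rfl⟩)).symm

theorem conf_append_blank_left (q : TSt) (L R : List Gam) :
    conf q (L ++ [.s0]) R = conf q L R := by
  simp only [conf, ListBlank.mk_append_blank]

theorem conf_append_blank_right (q : TSt) (L R : List Gam) :
    conf q L (R ++ [.s0]) = conf q L R := by
  simp only [conf, ListBlank.mk_append_blank]

/-- Iterated steps computed on lists; cells beyond the end of a list are blank. -/
def run : ℕ → TSt → List Gam → List Gam → Option Cfg
  | 0, q, L, R => some (conf q L R)
  | _ + 1, .H, _, _ => none
  | n + 1, q, L, R =>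
    match delta q R.headI with
    | (b, .left, q') => run n q' L.tail (L.headI :: b :: R.tail)
    | (b, .right, q') => run n q' (b :: L) R.tail

theorem step_conf {q : TSt} (hq : q ≠ .H) (L R : List Gam) :
    step (conf q L R) = some (match delta q R.headI with
      | (b, .left, q') => conf q' L.tail (L.headI :: b :: R.tail)
      | (b, .right, q') => conf q' (b :: L) R.tail) := by
  cases q <;> first | exact absurd rfl hq | skip
  all_goals rcases R with _ | ⟨_ | _ | _, R⟩ <;> rcases L with _ | ⟨y, L⟩ <;> rfl

theorem reaches_of_run {n : ℕ} {q : TSt} {L R : List Gam} {c : Cfg}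
    (h : run n q L R = some c) : reaches n (conf q L R) c := by
  induction n generalizing q L R with
  | zero => exact h
  | succ n ih =>
    have hq : q ≠ .H := by
      rintro rfl
      simp [run] at h
    unfold reaches at ih ⊢
    rw [Function.iterate_succ_apply, Option.bind_some, step_conf hq]
    rw [run.eq_3 _ _ _ _ hq] at h
    split at h <;> exact ih h

theorem replicate_append_cons (n : ℕ) (a : Gam) (L : List Gam) :
    List.replicate n a ++ a :: L = a :: (List.replicate n a ++ L) := by
  induction n with
  | zero => rfl
  | succ n ih => simp only [List.replicate_succ, List.cons_append, ih]

/-- In state `B` the head runs right over a block of `1`s, turning it into `2`s. -/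
theorem reaches_B_right (m : ℕ) (L R : List Gam) :
    reaches m (conf .B L (.replicate m .s1 ++ R)) (conf .B (.replicate m .s2 ++ L) R) := by
  induction m generalizing L with
  | zero => rfl
  | succ m ih =>
    have h : reaches 1 (conf .B L (.replicate (m + 1) .s1 ++ R))
        (conf .B (.s2 :: L) (.replicate m .s1 ++ R)) := reaches_of_run rfl
    refine reaches_congr (reaches_trans h (ih _)) (Nat.add_comm _ _) rfl ?_
    rw [replicate_append_cons]
    rfl

/-- In state `B` the head runs left over a block of `2`s, turning it into `1`s. -/
theorem reaches_B_left (m : ℕ) (x : Gam) (L R : List Gam) :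
    reaches (m + 1) (conf .B (.replicate m .s2 ++ x :: L) (.s2 :: R))
      (conf .B L (x :: .s1 :: (.replicate m .s1 ++ R))) := by
  induction m generalizing R with
  | zero => rfl
  | succ m ih =>
    have h : reaches 1 (conf .B (.replicate (m + 1) .s2 ++ x :: L) (.s2 :: R))
        (conf .B (.replicate m .s2 ++ x :: L) (.s2 :: .s1 :: R)) := reaches_of_run rfl
    refine reaches_congr (reaches_trans h (ih _)) (Nat.add_comm _ _) rfl ?_
    rw [replicate_append_cons]
    rfl

theorem reaches_B_sweep (a : ℕ) (x : Gam) (L R : List Gam) :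
    reaches (2 * a + 1) (conf .B (x :: L) (.replicate a .s1 ++ .s2 :: R))
      (conf .B L (x :: (.replicate (a + 1) .s1 ++ R))) :=
  reaches_congr (reaches_trans (reaches_B_right a _ _) (reaches_B_left a x L R))
    (by ring) rfl rfl

theorem reaches_B_sweeps (b a : ℕ) (L R : List Gam) :
    reaches (∑ i ∈ Finset.range b, (2 * (a + 2 * i) + 1))
      (conf .B (.replicate b .s1 ++ L) (.replicate a .s1 ++ (.replicate b .s2 ++ R)))
      (conf .B L (.replicate (a + 2 * b) .s1 ++ R)) := by
  induction b generalizing a with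
  | zero => rfl
  | succ b ih =>
    refine reaches_congr (reaches_trans (reaches_B_sweep a .s1 _ _) (ih (a + 2))) ?_ rfl ?_
    · rw [Finset.sum_range_succ', Nat.add_comm]
      congr 1
      exact Finset.sum_congr rfl fun i _ => by ring
    · rw [show a + 2 * (b + 1) = a + 2 + 2 * b by ring]

theorem reaches_B_restart (R : List Gam) :
    reaches 13 (conf .B [] (.s0 :: R)) (conf .B [.s1, .s1, .s1] R) :=
  reaches_of_run rfl

theorem reaches_B_cycle (a : ℕ) (R : List Gam) :
    reaches (8 * a + 41) (conf .B [] (.s0 :: (.replicate a .s1 ++ (.replicate 4 .s2 ++ R))))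
      (conf .B [] (.s0 :: (.replicate (a + 7) .s1 ++ R))) := by
  have h₁ := reaches_B_sweeps 3 a [] (.s2 :: R)
  have h₂ := reaches_B_sweep (a + 2 * 3) .s0 [] R
  have h₀ : conf .B [.s0] (.replicate (a + 2 * 3) .s1 ++ .s2 :: R) =
      conf .B [] (.replicate (a + 2 * 3) .s1 ++ .s2 :: R) := conf_append_blank_left _ [] _
  rw [h₀] at h₂
  refine reaches_congr (reaches_trans (reaches_B_restart _) (reaches_trans h₁ h₂)) ?_ rfl rfl
  simp only [Finset.sum_range_succ, Finset.sum_range_zero]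
  ring

theorem reaches_B_cycles (j a : ℕ) (R : List Gam) :
    reaches (28 * j ^ 2 + 13 * j + 8 * a * j)
      (conf .B [] (.s0 :: (.replicate a .s1 ++ (.replicate (4 * j) .s2 ++ R))))
      (conf .B [] (.s0 :: (.replicate (a + 7 * j) .s1 ++ R))) := by
  induction j generalizing a with
  | zero => rfl
  | succ j ih =>
    refine reaches_congr (reaches_trans (reaches_B_cycle a _) (ih (a + 7))) (by ring) ?_ ?_
    · rw [← List.append_assoc (List.replicate 4 _), List.replicate_append_replicate,
        show 4 + 4 * j = 4 * (j + 1) by ring]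
    · rw [show a + 7 * (j + 1) = a + 7 + 7 * j by ring]

/-- Crossing the right end of the tape and turning back in state `A`. -/
theorem reaches_turn (m : ℕ) (L : List Gam) :
    reaches (m + 12) (conf .B L (.replicate (m + 3) .s1))
      (conf .A (.replicate m .s2 ++ L) (.replicate 4 .s2)) := by
  have h₁ := reaches_B_right (m + 3) L []
  rw [List.append_nil] at h₁
  have h₂ : reaches 9 (conf .B (.replicate (m + 3) .s2 ++ L) [])
      (conf .A (.replicate m .s2 ++ L) (.replicate 4 .s2)) := by
    have h₃ : reaches 1 (conf .B (.replicate (m + 3) .s2 ++ L) [])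
      (conf .A (.replicate (m + 2) .s2 ++ L) ([.s2] ++ [.s0])) := reaches_of_run rfl
    rw [conf_append_blank_right] at h₃
    have h₄ : reaches 8 (conf .A (.replicate (m + 2) .s2 ++ L) [.s2])
      (conf .A (.replicate m .s2 ++ L) (.replicate 4 .s2 ++ [.s0])) := reaches_of_run rfl
    rw [conf_append_blank_right] at h₄
    exact reaches_trans h₃ h₄
  exact reaches_congr (reaches_trans h₁ h₂) (by ring) rfl rfl

/-- In state `A` the head moves left through a block of `2`s, two cells at a time. -/
theorem reaches_A_left (i r : ℕ) (L : List Gam) :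
    reaches (8 * i) (conf .A (.replicate (2 * i) .s2 ++ L) (.replicate (r + 3) .s2))
      (conf .A L (.replicate (r + 3 + 2 * i) .s2)) := by
  induction i generalizing r with
  | zero => rfl
  | succ i ih =>
    have h : reaches 8 (conf .A (.replicate (2 * (i + 1)) .s2 ++ L) (.replicate (r + 3) .s2))
      (conf .A (.replicate (2 * i) .s2 ++ L) (.replicate (r + 2 + 3) .s2)) := reaches_of_run rfl
    refine reaches_congr (reaches_trans h (ih (r + 2))) (by ring) rfl ?_
    rw [show r + 3 + 2 * (i + 1) = r + 2 + 3 + 2 * i by ring]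

/-- The machine consumes `2`s in groups of four and then returns to the left end of the tape;
`b + c = 3` where `b` is the number of `2`s in the last incomplete group, and `e` is the parity
correction for the return in steps of two. -/
theorem reaches_return (j b c e i r : ℕ) (hbc : b + c = 3)
    (hi : 7 * j + 2 * b = 2 * i + e) (hr : 2 * i + 4 = r) :
    reaches (28 * j ^ 2 + 37 * j + ∑ t ∈ Finset.range b, (2 * (3 + 7 * j + 2 * t) + 1)
        + 7 * j + 2 * b + 32 + 8 * i)
      (Cfg1 (4 * j + b + 2))
      (conf .A (.replicate e .s2 ++ .replicate c .s1) (.replicate r .s2)) := by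
  have h₀ : reaches 7 (Cfg1 (4 * j + b + 2))
      (conf .B [] (.s0 :: (.replicate 3 .s1 ++ .replicate (4 * j + b) .s2))) := reaches_of_run rfl
  have h₁ := reaches_B_cycles j 3 (.replicate b .s2)
  rw [List.replicate_append_replicate] at h₁
  have h₂ := reaches_B_restart (.replicate (3 + 7 * j) .s1 ++ .replicate b .s2)
  have h₃ := reaches_B_sweeps b (3 + 7 * j) (.replicate c .s1) []
  rw [List.append_nil, List.append_nil, List.replicate_append_replicate, hbc,
    show 3 + 7 * j + 2 * b = 7 * j + 2 * b + 3 by ring] at h₃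
  have h₄ := reaches_turn (7 * j + 2 * b) (.replicate c .s1)
  have h₅ := reaches_A_left i 1 (.replicate e .s2 ++ .replicate c .s1)
  rw [← List.append_assoc, List.replicate_append_replicate, ← hi] at h₅
  refine reaches_congr (reaches_trans h₀ <| reaches_trans h₁ <| reaches_trans h₂ <|
    reaches_trans h₃ <| reaches_trans h₄ h₅) (by ring) rfl ?_
  rw [← hr, Nat.add_comm (2 * i)]

theorem reaches_Cfg1_one : reaches 13 (Cfg1 1) (Cfg1 3) := by
  have h : reaches 13 (Cfg1 1) (conf .A [] ([.s0, .s2, .s2, .s2] ++ [.s0])) := reaches_of_run rfl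
  rwa [conf_append_blank_right] at h

theorem reaches_Cfg1_two (k : ℕ) :
    reaches (112 * k ^ 2 + 144 * k + 38) (Cfg1 (8 * k + 2)) (Cfg1 (14 * k + 7)) := by
  have h₁ := reaches_return (2 * k) 0 3 0 (7 * k) (14 * k + 4) rfl (by ring) (by ring)
  have h₂ : reaches 6 (conf .A (.replicate 0 .s2 ++ .replicate 3 .s1)
      (.replicate (14 * k + 4) .s2))
    (Cfg1 (14 * k + 7)) := reaches_of_run rfl
  refine reaches_congr (reaches_trans h₁ h₂) ?_ (by ring_nf) rfl
  simp only [Finset.sum_range_zero]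
  ring

theorem reaches_Cfg1_three (k : ℕ) :
    reaches (112 * k ^ 2 + 172 * k + 54) (Cfg1 (8 * k + 3)) (Cfg1 (14 * k + 8)) := by
  have h₁ := reaches_return (2 * k) 1 2 0 (7 * k + 1) (14 * k + 6) rfl (by ring) (by ring)
  have h₂ : reaches 5 (conf .A (.replicate 0 .s2 ++ .replicate 2 .s1)
      (.replicate (14 * k + 6) .s2))
    (Cfg1 (14 * k + 8)) := reaches_of_run rfl
  refine reaches_congr (reaches_trans h₁ h₂) ?_ (by ring_nf) rfl
  simp only [Finset.sum_range_succ, Finset.sum_range_zero]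
  ring

theorem reaches_Cfg1_four (k : ℕ) :
    reaches (112 * k ^ 2 + 200 * k + 74) (Cfg1 (8 * k + 4)) (Cfg1 (14 * k + 9)) := by
  have h₁ := reaches_return (2 * k) 2 1 0 (7 * k + 2) (14 * k + 8) rfl (by ring) (by ring)
  have h₂ : reaches 4 (conf .A (.replicate 0 .s2 ++ .replicate 1 .s1)
      (.replicate (14 * k + 8) .s2))
    (Cfg1 (14 * k + 9)) := reaches_of_run rfl
  refine reaches_congr (reaches_trans h₁ h₂) ?_ (by ring_nf) rfl
  simp only [Finset.sum_range_succ, Finset.sum_range_zero]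
  ring

theorem reaches_Cfg1_five (k : ℕ) :
    reaches (112 * k ^ 2 + 228 * k + 97) (Cfg1 (8 * k + 5))
      (mkCfg [.s1] .H .s1 (List.replicate (14 * k + 9) .s2)) := by
  have h₁ := reaches_return (2 * k) 3 0 0 (7 * k + 3) (14 * k + 10) rfl (by ring) (by ring)
  have h₂ : reaches 2 (conf .A (.replicate 0 .s2 ++ .replicate 0 .s1)
      (.replicate (14 * k + 10) .s2))
    (mkCfg [.s1] .H .s1 (List.replicate (14 * k + 9) .s2)) := reaches_of_run rfl
  refine reaches_congr (reaches_trans h₁ h₂) ?_ (by ring_nf) rfl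
  simp only [Finset.sum_range_succ, Finset.sum_range_zero]
  ring

theorem reaches_Cfg1_six (k : ℕ) :
    reaches (112 * k ^ 2 + 256 * k + 139) (Cfg1 (8 * k + 6)) (Cfg1 (14 * k + 14)) := by
  have h₁ := reaches_return (2 * k + 1) 0 3 1 (7 * k + 3) (14 * k + 10) rfl (by ring) (by ring)
  have h₂ : reaches 11 (conf .A (.replicate 1 .s2 ++ .replicate 3 .s1)
      (.replicate (14 * k + 10) .s2))
    (Cfg1 (14 * k + 14)) := reaches_of_run rfl
  refine reaches_congr (reaches_trans h₁ h₂) ?_ (by ring_nf) rfl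
  simp only [Finset.sum_range_zero]
  ring

theorem reaches_Cfg1_seven (k : ℕ) :
    reaches (112 * k ^ 2 + 284 * k + 169) (Cfg1 (8 * k + 7)) (Cfg1 (14 * k + 15)) := by
  have h₁ := reaches_return (2 * k + 1) 1 2 1 (7 * k + 4) (14 * k + 12) rfl (by ring) (by ring)
  have h₂ : reaches 10 (conf .A (.replicate 1 .s2 ++ .replicate 2 .s1)
      (.replicate (14 * k + 12) .s2))
    (Cfg1 (14 * k + 15)) := reaches_of_run rfl
  refine reaches_congr (reaches_trans h₁ h₂) ?_ (by ring_nf) rfl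
  simp only [Finset.sum_range_succ, Finset.sum_range_zero]
  ring

theorem reaches_Cfg1_eight (k : ℕ) :
    reaches (112 * k ^ 2 + 312 * k + 203) (Cfg1 (8 * k + 8)) (Cfg1 (14 * k + 16)) := by
  have h₁ := reaches_return (2 * k + 1) 2 1 1 (7 * k + 5) (14 * k + 14) rfl (by ring) (by ring)
  have h₂ : reaches 9 (conf .A (.replicate 1 .s2 ++ .replicate 1 .s1)
      (.replicate (14 * k + 14) .s2))
    (Cfg1 (14 * k + 16)) := reaches_of_run rfl
  refine reaches_congr (reaches_trans h₁ h₂) ?_ (by ring_nf) rfl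
  simp only [Finset.sum_range_succ, Finset.sum_range_zero]
  ring

theorem reaches_Cfg1_nine (k : ℕ) :
    reaches (112 * k ^ 2 + 340 * k + 241) (Cfg1 (8 * k + 9)) (Cfg1 (14 * k + 17)) := by
  have h₁ := reaches_return (2 * k + 1) 3 0 1 (7 * k + 6) (14 * k + 16) rfl (by ring) (by ring)
  have h₂ : reaches 8 (conf .A (.replicate 1 .s2 ++ .replicate 0 .s1)
      (.replicate (14 * k + 16) .s2))
    (Cfg1 (14 * k + 17)) := reaches_of_run rfl
  refine reaches_congr (reaches_trans h₁ h₂) ?_ (by ring_nf) rfl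
  simp only [Finset.sum_range_succ, Finset.sum_range_zero]
  ring

theorem stmt0 :
    reaches 3 (mkCfg [] .A .s0 []) (Cfg1 1) ∧
    ∀ k : ℕ,
      reaches (112*k^2 + 116*k + 13) (Cfg1 (8*k+1)) (Cfg1 (14*k+3)) ∧
      reaches (112*k^2 + 144*k + 38) (Cfg1 (8*k+2)) (Cfg1 (14*k+7)) ∧
      reaches (112*k^2 + 172*k + 54) (Cfg1 (8*k+3)) (Cfg1 (14*k+8)) ∧
      reaches (112*k^2 + 200*k + 74) (Cfg1 (8*k+4)) (Cfg1 (14*k+9)) ∧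
      reaches (112*k^2 + 228*k + 97) (Cfg1 (8*k+5))
        (mkCfg [.s1] .H .s1 (List.replicate (14*k+9) .s2)) ∧
      reaches (112*k^2 + 256*k + 139) (Cfg1 (8*k+6)) (Cfg1 (14*k+14)) ∧
      reaches (112*k^2 + 284*k + 169) (Cfg1 (8*k+7)) (Cfg1 (14*k+15)) ∧
      reaches (112*k^2 + 312*k + 203) (Cfg1 (8*k+8)) (Cfg1 (14*k+16)) := by
  refine ⟨?_, fun k => ⟨?_, reaches_Cfg1_two k, reaches_Cfg1_three k, reaches_Cfg1_four k,
    reaches_Cfg1_five k, reaches_Cfg1_six k, reaches_Cfg1_seven k, reaches_Cfg1_eight k⟩⟩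
  · have h : reaches 3 (mkCfg [] .A .s0 []) (conf .A [] ([.s0, .s2] ++ [.s0])) := reaches_of_run rfl
    rwa [conf_append_blank_right] at h
  cases k with
  | zero => exact reaches_Cfg1_one
  | succ k => exact reaches_congr (reaches_Cfg1_nine k) (by ring) (by ring_nf) (by ring_nf)
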